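/- Let H be a real number with 1/2 < H < 1 and let ε > 0. Let D_ε = {(s,y) ∈ ℝ² : |s| + |y| ≤ ε/√2} (the diamond obtained by rotating a square of side length ε by 45 degrees). Then ∫_ℝ ( ∫_ℝ ∫_ℝ 1_{D_ε}(s,y) · 1_{D_ε}(s,y') · |y−y'|^{2H−2} dy' dy ) ds = 2^{H+1/2} · ε^{2H+1} / ((2H+1)·H·(2H−1)). -/

import Mathlib

open MeasureTheory

lemma abs_rpow_eqOn_uIoc {c : ℝ} (p : ℝ) (hc : 0 ≤ c) :
    Set.EqOn (fun x : ℝ => x ^ p) (fun x : ℝ => |x| ^ p) (Set.uIoc 0 c) := by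
  intro x hx
  rw [Set.uIoc_of_le hc] at hx
  simp only [abs_of_pos hx.1]

lemma intervalIntegrable_abs_rpow_zero_left {p c : ℝ} (hp : -1 < p) (hc : 0 ≤ c) :
    IntervalIntegrable (fun x : ℝ => |x| ^ p) volume 0 c :=
  (intervalIntegral.intervalIntegrable_rpow' hp).congr (abs_rpow_eqOn_uIoc p hc)

lemma integral_abs_rpow_zero_left {p c : ℝ} (hp : -1 < p) (hc : 0 ≤ c) :
    ∫ x in (0 : ℝ)..c, |x| ^ p = c ^ (p + 1) / (p + 1) := by
  rw [← intervalIntegral.integral_congr_ae (.of_forall (abs_rpow_eqOn_uIoc p hc)),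
    integral_rpow (Or.inl hp), Real.zero_rpow (by linarith), sub_zero]

lemma integral_neg_abs_rpow {p b c : ℝ} (hp : -1 < p) (hb : 0 ≤ b) (hc : 0 ≤ c) :
    ∫ x in (-b)..c, |x| ^ p = (b ^ (p + 1) + c ^ (p + 1)) / (p + 1) := by
  have hint : IntervalIntegrable (fun x : ℝ => |x| ^ p) volume (-b) 0 := by
    simpa using ((IntervalIntegrable.iff_comp_neg (by simp)).1
      (intervalIntegrable_abs_rpow_zero_left hp hb)).symm
  have hleft : ∫ x in (-b)..0, |x| ^ p = b ^ (p + 1) / (p + 1) := by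
    have h := intervalIntegral.integral_comp_neg (a := 0) (b := b) (fun x : ℝ => |x| ^ p)
    simp only [abs_neg, neg_zero] at h
    rw [← h, integral_abs_rpow_zero_left hp hb]
  rw [← intervalIntegral.integral_add_adjacent_intervals hint
    (intervalIntegrable_abs_rpow_zero_left hp hc), hleft, integral_abs_rpow_zero_left hp hc,
    add_div]

lemma integral_abs_sub_rpow {p r y : ℝ} (hp : -1 < p) (hy : y ∈ Set.Icc (-r) r) :
    ∫ x in (-r)..r, |y - x| ^ p = ((r - y) ^ (p + 1) + (r + y) ^ (p + 1)) / (p + 1) := by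
  rw [intervalIntegral.integral_comp_sub_left (fun x : ℝ => |x| ^ p) y,
    show y - r = -(r - y) by ring, show y - -r = r + y by ring,
    integral_neg_abs_rpow hp (by linarith [hy.2]) (by linarith [hy.1])]

/-- The Riesz energy of the interval `[-r, r]`. -/
lemma integral_integral_abs_sub_rpow {p r : ℝ} (hp : -1 < p) (hr : 0 ≤ r) :
    ∫ y in (-r)..r, ∫ x in (-r)..r, |y - x| ^ p =
      2 * (2 * r) ^ (p + 2) / ((p + 1) * (p + 2)) := by
  have hcongr : Set.EqOn (fun y : ℝ => ∫ x in (-r)..r, |y - x| ^ p)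
      (fun y => ((r - y) ^ (p + 1) + (r + y) ^ (p + 1)) / (p + 1)) (Set.uIcc (-r) r) := by
    intro y hy
    rw [Set.uIcc_of_le (by linarith)] at hy
    exact integral_abs_sub_rpow hp hy
  have hcont : Continuous fun y : ℝ => y ^ (p + 1) := Real.continuous_rpow_const (by linarith)
  have hleft : Continuous fun y : ℝ => (r - y) ^ (p + 1) :=
    hcont.comp (continuous_const.sub continuous_id)
  have hright : Continuous fun y : ℝ => (r + y) ^ (p + 1) :=
    hcont.comp (continuous_const.add continuous_id)
  have h1 : p + 1 ≠ 0 := by linarith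
  have h2 : p + 2 ≠ 0 := by linarith
  rw [intervalIntegral.integral_congr hcongr, intervalIntegral.integral_div,
    intervalIntegral.integral_add (hleft.intervalIntegrable _ _) (hright.intervalIntegrable _ _),
    intervalIntegral.integral_comp_sub_left (fun x : ℝ => x ^ (p + 1)) r,
    intervalIntegral.integral_comp_add_left (fun x : ℝ => x ^ (p + 1)) r,
    sub_self, add_neg_cancel, sub_neg_eq_add, ← two_mul r,
    integral_rpow (Or.inl (by linarith)), show p + 1 + 1 = p + 2 by ring, Real.zero_rpow h2]
  field_simp
  ring

/-- Each time slice of the diamond contributes the Riesz energy of an interval. -/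
lemma integral_diamond_slice {p : ℝ} (hp : -1 < p) (a s : ℝ) :
    (∫ y : ℝ, ∫ y' : ℝ,
        Set.indicator {q : ℝ × ℝ | |q.1| + |q.2| ≤ a} 1 (s, y) *
        Set.indicator {q : ℝ × ℝ | |q.1| + |q.2| ≤ a} 1 (s, y') * |y - y'| ^ p) =
      Set.indicator (Set.Icc (-a) a)
        (fun s => 2 * (2 * (a - |s|)) ^ (p + 2) / ((p + 1) * (p + 2))) s := by
  have hind : ∀ y : ℝ, Set.indicator {q : ℝ × ℝ | |q.1| + |q.2| ≤ a} (1 : ℝ × ℝ → ℝ) (s, y) =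
      Set.indicator (Set.Icc (-(a - |s|)) (a - |s|)) 1 y := by
    intro y
    have hmem : |s| + |y| ≤ a ↔ -(a - |s|) ≤ y ∧ y ≤ a - |s| := by
      rw [← abs_le, le_sub_iff_add_le']
    simp only [Set.indicator_apply, Set.mem_ofPred_eq, Set.mem_Icc, hmem, Pi.one_apply]
  simp only [hind]
  by_cases hs : s ∈ Set.Icc (-a) a
  · have hr : 0 ≤ a - |s| := sub_nonneg.2 (abs_le.2 hs)
    rw [Set.indicator_of_mem hs, ← integral_integral_abs_sub_rpow hp hr]
    generalize a - |s| = r at hr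
    have hle : -r ≤ r := by linarith
    rw [intervalIntegral.integral_of_le hle, ← integral_Icc_eq_integral_Ioc,
      ← integral_indicator measurableSet_Icc]
    congr 1
    ext y
    simp only [mul_assoc, integral_const_mul]
    have hslice : ∫ x in (-r)..r, |y - x| ^ p =
        ∫ x, Set.indicator (Set.Icc (-r) r) 1 x * |y - x| ^ p := by
      rw [intervalIntegral.integral_of_le hle, ← integral_Icc_eq_integral_Ioc,
        ← integral_indicator measurableSet_Icc]
      simp [Set.indicator_apply]
    simp only [Set.indicator_apply _ _ y, hslice, Pi.one_apply, ite_mul, one_mul, zero_mul]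
  · have hr : a - |s| < 0 := sub_neg.2 (not_le.1 fun h => hs (abs_le.1 h))
    rw [Set.indicator_of_notMem hs, Set.Icc_eq_empty (by linarith)]
    simp

lemma integral_sub_abs_rpow {a q : ℝ} (ha : 0 ≤ a) (hq : 0 ≤ q) :
    ∫ s in (-a)..a, (2 * (a - |s|)) ^ q = (2 * a) ^ (q + 1) / (q + 1) := by
  have hcont : Continuous fun s : ℝ => (2 * (a - |s|)) ^ q :=
    (Real.continuous_rpow_const hq).comp (by fun_prop)
  have hright : ∫ s in (0 : ℝ)..a, (2 * (a - |s|)) ^ q = (2 * a) ^ (q + 1) / (2 * (q + 1)) := by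
    have hcongr : Set.EqOn (fun s : ℝ => (2 * (a - |s|)) ^ q) (fun s => (2 * a - 2 * s) ^ q)
        (Set.uIcc 0 a) := by
      intro s hs
      rw [Set.uIcc_of_le ha] at hs
      simp only [abs_of_nonneg hs.1, mul_sub]
    rw [intervalIntegral.integral_congr hcongr,
      intervalIntegral.integral_comp_sub_mul (fun x : ℝ => x ^ q) two_ne_zero (2 * a),
      integral_rpow (Or.inl (by linarith)), sub_self, mul_zero, sub_zero,
      Real.zero_rpow (by linarith), smul_eq_mul]
    field_simp
    ring
  have hleft : ∫ s in (-a)..0, (2 * (a - |s|)) ^ q = (2 * a) ^ (q + 1) / (2 * (q + 1)) := by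
    have h := intervalIntegral.integral_comp_neg (a := 0) (b := a)
      (fun s : ℝ => (2 * (a - |s|)) ^ q)
    simp only [abs_neg, neg_zero] at h
    rw [← h, hright]
  rw [← intervalIntegral.integral_add_adjacent_intervals (hcont.intervalIntegrable (-a) 0)
    (hcont.intervalIntegrable 0 a), hleft, hright]
  field_simp
  ring

/-- The Riesz-kernel integral over the diamond `D_ε = {|s|+|y| ≤ ε/√2}`, which
underlies the exact second moment of the rectangular increment of the solution of
the linear stochastic wave equation in rotated coordinates. -/
theorem riesz_diamond_integral (H ε : ℝ) (hH₁ : 1/2 < H) (hH₂ : H < 1) (hε : 0 < ε) :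
    (∫ s : ℝ, ∫ y : ℝ, ∫ y' : ℝ,
        Set.indicator {p : ℝ × ℝ | |p.1| + |p.2| ≤ ε / Real.sqrt 2} 1 (s, y) *
        Set.indicator {p : ℝ × ℝ | |p.1| + |p.2| ≤ ε / Real.sqrt 2} 1 (s, y') *
        |y - y'| ^ (2*H - 2)) =
      (2 : ℝ) ^ (H + 1/2) * ε ^ (2*H + 1) / ((2*H + 1) * H * (2*H - 1)) := by
  have hp : -1 < 2 * H - 2 := by linarith
  have ha : 0 ≤ ε / Real.sqrt 2 := by positivity
  have hpow : (2 * (ε / Real.sqrt 2)) ^ (2 * H + 1) = 2 ^ (H + 1 / 2) * ε ^ (2 * H + 1) := by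
    have hsqrt : 2 * (ε / Real.sqrt 2) = 2 ^ (1 / 2 : ℝ) * ε := by
      rw [← Real.sqrt_eq_rpow, mul_div_left_comm, Real.div_sqrt, mul_comm]
    rw [hsqrt, Real.mul_rpow (by positivity) hε.le, ← Real.rpow_mul zero_le_two]
    congr 2
    ring
  simp only [integral_diamond_slice hp]
  rw [integral_indicator measurableSet_Icc, integral_Icc_eq_integral_Ioc,
    ← intervalIntegral.integral_of_le (by linarith), intervalIntegral.integral_div,
    intervalIntegral.integral_const_mul, sub_add_cancel,
    integral_sub_abs_rpow ha (by linarith), hpow, show 2 * H - 2 + 1 = 2 * H - 1 by ring]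
  have h1 : 2 * H - 1 ≠ 0 := by linarith
  have h2 : 2 * H + 1 ≠ 0 := by linarith
  have h3 : H ≠ 0 := by linarith
  field_simp
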